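/- Let m ∈ ℕ and let X be an ergodic ℝ^m-system. Then there exists an at most countable family (ℓ_j)_{j∈J} of hyperplanes of ℝ^m such that for every α ∈ ℝ^m with α ∉ ⋃_{j∈J} ℓ_j, the map T_α is ergodic, i.e. every measurable set A with μ(T_α⁻¹A Δ A) = 0 satisfies μ(A) = 0 or μ(A) = 1. -/

import Mathlib

open MeasureTheory Filter Topology

structure RSystem (m : ℕ) (X : Type*) [MeasurableSpace X] (μ : Measure X) where
  T : (Fin m → ℝ) → X → X
  measurable_pair : Measurable fun p : (Fin m → ℝ) × X => T p.1 p.2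
  measurePreserving : ∀ α, MeasurePreserving (T α) μ μ
  T_zero : T 0 = id
  T_add : ∀ α β, T α ∘ T β = T (α + β)
  separableL2 : TopologicalSpace.SeparableSpace (Lp ℂ 2 μ)

namespace RSystem

variable {m : ℕ} {X : Type*} [MeasurableSpace X] {μ : Measure X}

/-- The system is ergodic. -/
def IsErgodic (S : RSystem m X μ) : Prop :=
  ∀ A : Set X, MeasurableSet A → (∀ α, μ (symmDiff (S.T α ⁻¹' A) A) = 0) →
    μ A = 0 ∨ μ A = 1

end RSystem

/-- A set of reals has density one. -/
def HasDensityOne (A : Set ℝ) : Prop :=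
  Tendsto (fun T' : ℝ => (volume (A ∩ Set.Icc 0 T')).toReal / T') atTop (nhds 1)

namespace RSystem

variable {m : ℕ} {X : Type*} [MeasurableSpace X] {μ : Measure X}

/-- `ν` is weakly equidistributed for the system. -/
def WeaklyEquidistributed (S : RSystem m X μ) (ν : Measure (Fin m → ℝ)) : Prop :=
  ∃ A : Set ℝ, MeasurableSet A ∧ HasDensityOne A ∧
    ∀ f : X → ℂ, Measurable f → (∃ C, ∀ x, ‖f x‖ ≤ C) →
      ∀ᵐ x ∂μ, Tendsto (fun t : ℝ => ∫ α, f (S.T (t • α) x) ∂ν)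
        (atTop ⊓ Filter.principal A) (nhds (∫ x, f x ∂μ))

/-- The system is good for double Birkhoff averages. -/
def GoodForDoubleBirkhoff (S : RSystem m X μ) : Prop :=
  ∀ (f₁ f₂ : X → ℂ), Measurable f₁ → Measurable f₂ →
    (∃ C, ∀ x, ‖f₁ x‖ ≤ C) → (∃ C, ∀ x, ‖f₂ x‖ ≤ C) →
    ∀ α₁ α₂ : Fin m → ℝ, ∀ᵐ x ∂μ, ∃ L : ℂ,
      Tendsto (fun T' : ℝ => (1 / T' : ℝ) •
          ∫ t in Set.Ioc (0:ℝ) T', f₁ (S.T (t • α₁) x) * f₂ (S.T (t • α₂) x))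
        atTop (nhds L)

/-- The σ-algebra (collection of sets) invariant under `T_g`, `g ∈ H`, up to null sets. -/
def InvSets (S : RSystem m X μ) (H : Set (Fin m → ℝ)) : Set (Set X) :=
  {A | MeasurableSet A ∧ ∀ g ∈ H, μ (symmDiff (S.T g ⁻¹' A) A) = 0}

/-- The set of non-ergodic directions. -/
def W (S : RSystem m X μ) : Set (Fin m → ℝ) :=
  {α | S.InvSets (Set.range fun t : ℝ => t • α) ≠ S.InvSets Set.univ}

end RSystem

/-- A hyperplane of `ℝ^m`: a translate of an `(m-1)`-dimensional linear subspace. -/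
def IsHyperplane (m : ℕ) (ℓ : Set (Fin m → ℝ)) : Prop :=
  ∃ (V : Submodule ℝ (Fin m → ℝ)) (β : Fin m → ℝ),
    Module.finrank ℝ V = m - 1 ∧ ℓ = (fun v => v + β) '' (V : Set (Fin m → ℝ))

section JointEigenspace

variable {V H : Type*} [AddCommGroup V] [Module ℝ V]
  [NormedAddCommGroup H] [InnerProductSpace ℂ H]

/-- The vectors of `K` on which `U v` acts as multiplication by `exp (2πic)` for every
`(v, c) ∈ W`. -/
noncomputable def jointEigenspace (U : V → H →L[ℂ] H) (K : Submodule ℂ H)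
    (W : Submodule ℝ (V × ℝ)) : Submodule ℂ H :=
  K ⊓ ⨅ p ∈ W, (U p.1 - Complex.exp (2 * Real.pi * Complex.I * p.2) •
    ContinuousLinearMap.id ℂ H).ker

theorem mem_jointEigenspace {U : V → H →L[ℂ] H} {K : Submodule ℂ H} {W : Submodule ℝ (V × ℝ)}
    {f : H} : f ∈ jointEigenspace U K W ↔
      f ∈ K ∧ ∀ p ∈ W, U p.1 f = Complex.exp (2 * Real.pi * Complex.I * p.2) • f := by
  simp [jointEigenspace, Submodule.mem_iInf, sub_eq_zero]

theorem isClosed_jointEigenspace {U : V → H →L[ℂ] H} {K : Submodule ℂ H}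
    (hK : IsClosed (K : Set H)) (W : Submodule ℝ (V × ℝ)) :
    IsClosed (jointEigenspace U K W : Set H) := by
  simp only [jointEigenspace, Submodule.coe_inf, Submodule.coe_iInf]
  exact hK.inter (isClosed_iInter fun p => isClosed_iInter fun _ =>
    ContinuousLinearMap.isClosed_ker _)

theorem mem_jointEigenspace_sup {U : V → H →L[ℂ] H} (hadd : ∀ a b f, U (a + b) f = U a (U b f))
    {K : Submodule ℂ H} {W₁ W₂ : Submodule ℝ (V × ℝ)} {f : H}
    (h₁ : f ∈ jointEigenspace U K W₁) (h₂ : f ∈ jointEigenspace U K W₂) :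
    f ∈ jointEigenspace U K (W₁ ⊔ W₂) := by
  rw [mem_jointEigenspace] at *
  refine ⟨h₁.1, fun p hp => ?_⟩
  obtain ⟨a, ha, b, hb, rfl⟩ := Submodule.mem_sup.1 hp
  rw [Prod.fst_add, hadd, h₂.2 b hb, map_smul, h₁.2 a ha, smul_smul, ← Complex.exp_add]
  congr 2
  push_cast [Prod.snd_add]
  ring

theorem map_mem_jointEigenspace {U : V → H →L[ℂ] H} (hadd : ∀ a b f, U (a + b) f = U a (U b f))
    {K : Submodule ℂ H} (hK : ∀ v, ∀ f ∈ K, U v f ∈ K) (W : Submodule ℝ (V × ℝ)) (v : V) {f : H}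
    (hf : f ∈ jointEigenspace U K W) : U v f ∈ jointEigenspace U K W := by
  rw [mem_jointEigenspace] at *
  refine ⟨hK v f hf.1, fun p hp => ?_⟩
  rw [← hadd, add_comm, hadd, hf.2 p hp, map_smul]

theorem countable_of_pairwise_inner_eq_zero [TopologicalSpace.SeparableSpace H] {ι : Type*}
    {s : Set ι} (E : ι → Submodule ℂ H) (hE : ∀ i ∈ s, E i ≠ ⊥)
    (horth : s.Pairwise fun i j => ∀ f ∈ E i, ∀ g ∈ E j, inner ℂ f g = 0) : s.Countable := by
  have hex : ∀ i ∈ s, ∃ f ∈ E i, ‖f‖ = 1 := fun i hi => by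
    obtain ⟨f, hf, hf0⟩ := (Submodule.ne_bot_iff _).1 (hE i hi)
    exact ⟨((‖f‖⁻¹ : ℝ) : ℂ) • f, (E i).smul_mem _ hf, by
      rw [norm_smul]; simp [norm_ne_zero_iff.2 hf0]⟩
  choose! e heE he1 using hex
  refine Set.PairwiseDisjoint.countable_of_isOpen (s := fun i => Metric.ball (e i) (1 / 2))
    (fun i hi j hj hij => ?_) (fun i _ => Metric.isOpen_ball)
    (fun i _ => ⟨e i, Metric.mem_ball_self (by norm_num)⟩)
  refine Metric.ball_disjoint_ball ?_
  have h := @norm_sub_sq ℂ H _ _ _ (e i) (e j)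
  rw [horth hi hj hij _ (heE i hi) _ (heE j hj), he1 i hi, he1 j hj] at h
  rw [dist_eq_norm]
  norm_num at h ⊢
  nlinarith [norm_nonneg (e i - e j)]

variable [CompleteSpace H]

theorem inner_eq_zero_of_jointEigenspace_sup_eq_bot {U : V → H →L[ℂ] H}
    (hzero : ∀ f, U 0 f = f) (hadd : ∀ a b f, U (a + b) f = U a (U b f))
    (hinner : ∀ v f g, inner ℂ (U v f) (U v g) = inner ℂ f g)
    {K : Submodule ℂ H} (hKc : IsClosed (K : Set H)) (hK : ∀ v, ∀ f ∈ K, U v f ∈ K)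
    {W₁ W₂ : Submodule ℝ (V × ℝ)} (hsup : jointEigenspace U K (W₁ ⊔ W₂) = ⊥) {f g : H}
    (hf : f ∈ jointEigenspace U K W₁) (hg : g ∈ jointEigenspace U K W₂) :
    inner ℂ g f = 0 := by
  set E := jointEigenspace U K W₂
  have : CompleteSpace E := (isClosed_jointEigenspace hKc W₂).completeSpace_coe
  obtain ⟨p, hp, q, hq, rfl⟩ := E.exists_add_mem_mem_orthogonal f
  have hUq : ∀ v, U v q ∈ Eᗮ := fun v => by
    rw [Submodule.mem_orthogonal]
    intro u hu
    have := hinner v (U (-v) u) q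
    rw [← hadd, add_neg_cancel, hzero] at this
    rw [this]
    exact (Submodule.mem_orthogonal _ _).1 hq _ (map_mem_jointEigenspace hadd hK W₂ _ hu)
  have hp' : p ∈ jointEigenspace U K W₁ := by
    rw [mem_jointEigenspace] at hf ⊢
    refine ⟨(mem_jointEigenspace.1 hp).1, fun w hw => ?_⟩
    set c := Complex.exp (2 * Real.pi * Complex.I * w.2)
    have h1 : U w.1 p - c • p ∈ E :=
      E.sub_mem (map_mem_jointEigenspace hadd hK W₂ _ hp) (E.smul_mem _ hp)
    have h2 : U w.1 p - c • p ∈ Eᗮ := by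
      have h3 := hf.2 w hw
      rw [map_add, smul_add] at h3
      have h4 : U w.1 p - c • p = c • q - U w.1 q := by
        rw [sub_eq_sub_iff_add_eq_add, h3, add_comm]
      rw [h4]
      exact Eᗮ.sub_mem (Eᗮ.smul_mem _ hq) (hUq _)
    exact sub_eq_zero.1 (Submodule.disjoint_def.1 E.orthogonal_disjoint _ h1 h2)
  have hp0 : p = 0 := by
    have := mem_jointEigenspace_sup hadd hp' hp
    rwa [hsup, Submodule.mem_bot] at this
  rw [hp0, zero_add]
  exact (Submodule.mem_orthogonal _ _).1 hq _ hg

theorem exists_countable_jointEigenspace_cover [FiniteDimensional ℝ V]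
    [TopologicalSpace.SeparableSpace H] {U : V → H →L[ℂ] H}
    (hzero : ∀ f, U 0 f = f) (hadd : ∀ a b f, U (a + b) f = U a (U b f))
    (hinner : ∀ v f g, inner ℂ (U v f) (U v g) = inner ℂ f g)
    {K : Submodule ℂ H} (hKc : IsClosed (K : Set H)) (hK : ∀ v, ∀ f ∈ K, U v f ∈ K) :
    ∃ M : Set (Submodule ℝ (V × ℝ)), M.Countable ∧ (∀ W ∈ M, jointEigenspace U K W ≠ ⊥) ∧
      ∀ W, jointEigenspace U K W ≠ ⊥ → ∃ W' ∈ M, W ≤ W' := by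
  refine ⟨{W | Maximal (fun W => jointEigenspace U K W ≠ ⊥) W}, ?_,
    fun W (hW : Maximal (fun W => jointEigenspace U K W ≠ ⊥) W) => hW.prop,
    fun W hW => ?_⟩
  · refine countable_of_pairwise_inner_eq_zero (jointEigenspace U K)
      (fun W (hW : Maximal (fun W => jointEigenspace U K W ≠ ⊥) W) => hW.prop) ?_
    intro W₁ h₁ W₂ h₂ hne f hf g hg
    refine inner_eq_zero_of_jointEigenspace_sup_eq_bot hzero hadd hinner hKc hK
      (W₁ := W₂) (W₂ := W₁) ?_ hg hf
    by_contra hbot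
    change Maximal (fun W => jointEigenspace U K W ≠ ⊥) W₁ at h₁
    change Maximal (fun W => jointEigenspace U K W ≠ ⊥) W₂ at h₂
    exact hne ((h₁.eq_of_le hbot le_sup_right).trans (h₂.eq_of_le hbot le_sup_left).symm)
  · obtain ⟨W', hle, hW'⟩ := exists_maximal_ge_of_wellFoundedGT
      (fun W => jointEigenspace U K W ≠ ⊥) W hW
    exact ⟨W', hW', hle⟩

end JointEigenspace

theorem exists_isHyperplane_superset (m : ℕ) (W : Submodule ℝ ((Fin m → ℝ) × ℝ))
    (hW : ∃ v, ((v, 0) : (Fin m → ℝ) × ℝ) ∉ W) (c : ℝ) :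
    ∃ ℓ, IsHyperplane m ℓ ∧ {v | (v, c) ∈ W} ⊆ ℓ := by
  let S : Submodule ℝ (Fin m → ℝ) := W.comap (LinearMap.inl ℝ _ _)
  have hS : ∀ v, v ∈ S ↔ (v, 0) ∈ W := fun v => by simp [S]
  have hlt : S < ⊤ := by
    obtain ⟨v, hv⟩ := hW
    exact lt_top_iff_ne_top.2 fun h => hv ((hS v).1 (h ▸ Submodule.mem_top))
  obtain ⟨φ, hφ, hle⟩ := S.exists_le_ker_of_lt_top hlt
  have hrank : Module.finrank ℝ φ.ker = m - 1 := by
    have := Module.Dual.finrank_ker_add_one_of_ne_zero hφ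
    simp only [Module.finrank_fin_fun] at this
    omega
  by_cases hne : ∃ β, (β, c) ∈ W
  · obtain ⟨β, hβ⟩ := hne
    refine ⟨_, ⟨φ.ker, β, hrank, rfl⟩, fun v hv => ⟨v - β, hle ((hS _).2 ?_), by simp⟩⟩
    simpa using W.sub_mem hv hβ
  · exact ⟨_, ⟨φ.ker, 0, hrank, rfl⟩, fun v hv => (hne ⟨v, hv⟩).elim⟩

section FlowFourier

variable {X : Type*}

/-- The `n`-th Fourier coefficient of the observable `g` along the orbit of `x` over one unit
of time. -/
noncomputable def orbitFourierCoeff (φ : ℝ → X → X) (g : X → ℂ) (n : ℤ) (x : X) : ℂ :=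
  ∫ t in (0 : ℝ)..1, Complex.exp (-(2 * Real.pi * Complex.I * (n * t))) * g (φ t x)

theorem norm_exp_neg_two_pi_I_mul (n : ℤ) (t : ℝ) :
    ‖Complex.exp (-(2 * Real.pi * Complex.I * (n * t)))‖ = 1 := by
  rw [show -(2 * Real.pi * Complex.I * (n * t)) = ((-(2 * Real.pi * (n * t)) : ℝ) : ℂ) * Complex.I
    by push_cast; ring]
  exact Complex.norm_exp_ofReal_mul_I _

theorem norm_orbitFourierCoeff_le {φ : ℝ → X → X} {g : X → ℂ} {C : ℝ}
    (hC : ∀ x, ‖g x‖ ≤ C) (n : ℤ) (x : X) :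
    ‖orbitFourierCoeff φ g n x‖ ≤ C := by
  have := intervalIntegral.norm_integral_le_of_norm_le_const (a := (0 : ℝ)) (b := 1) (C := C)
    (f := fun t : ℝ => Complex.exp (-(2 * Real.pi * Complex.I * (n * t))) * g (φ t x))
    (fun t _ => by rw [norm_mul, norm_exp_neg_two_pi_I_mul, one_mul]; exact hC _)
  simpa [orbitFourierCoeff] using this

theorem ae_eq_zero_of_forall_fourier_eq_zero {h : ℝ → ℂ} (hm : Measurable h) {C : ℝ}
    (hC : ∀ t, ‖h t‖ ≤ C)
    (h0 : ∀ n : ℤ, ∫ t in (0 : ℝ)..1,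
      Complex.exp (-(2 * Real.pi * Complex.I * (n * t))) * h t = 0) :
    ∀ᵐ t ∂volume.restrict (Set.Ioc (0 : ℝ) 1), h t = 0 := by
  have hL2 : MemLp h 2 (volume.restrict (Set.Ioc (0 : ℝ) 1)) :=
    MemLp.of_bound hm.aestronglyMeasurable C (ae_of_all _ hC)
  have hsum := hasSum_sq_fourierCoeffOn zero_lt_one hL2
  have hc : ∀ n, fourierCoeffOn zero_lt_one h n = 0 := fun n => by
    rw [fourierCoeffOn_eq_integral]
    convert smul_zero _
    rw [← h0 n]
    refine intervalIntegral.integral_congr fun t _ => ?_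
    simp only [smul_eq_mul]
    congr 1
    rw [fourier_coe_apply]
    congr 1
    push_cast
    ring
  simp only [hc, norm_zero, ne_eq, OfNat.ofNat_ne_zero, not_false_eq_true, zero_pow] at hsum
  have h1 := hsum.unique hasSum_zero
  rw [sub_zero, inv_one, one_smul, intervalIntegral.integral_of_le zero_le_one,
    integral_eq_zero_iff_of_nonneg (fun t => by positivity)] at h1
  · filter_upwards [h1] with t ht
    simpa using ht
  · exact hL2.integrable_norm_pow (by norm_num)

variable [MeasurableSpace X] {μ : Measure X} {φ : ℝ → X → X} {g : X → ℂ} {C : ℝ}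

theorem measurable_orbitFourierCoeff (hφ : Measurable fun p : ℝ × X => φ p.1 p.2)
    (hg : Measurable g) (n : ℤ) : Measurable (orbitFourierCoeff φ g n) := by
  unfold orbitFourierCoeff
  simp only [intervalIntegral.integral_of_le zero_le_one]
  refine (StronglyMeasurable.integral_prod_right' (f := fun p : X × ℝ =>
    Complex.exp (-(2 * Real.pi * Complex.I * (n * p.2))) * g (φ p.2 p.1)) ?_).measurable
  exact (Measurable.mul (by fun_prop)
    (hg.comp (hφ.comp measurable_swap))).stronglyMeasurable

variable [IsProbabilityMeasure μ]

theorem integral_orbitFourierCoeff (hφ : Measurable fun p : ℝ × X => φ p.1 p.2)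
    (hmp : ∀ t, MeasurePreserving (φ t) μ μ) (hg : Measurable g) (hC : ∀ x, ‖g x‖ ≤ C)
    (hint : ∫ x, g x ∂μ = 0) (n : ℤ) : ∫ x, orbitFourierCoeff φ g n x ∂μ = 0 := by
  unfold orbitFourierCoeff
  simp only [intervalIntegral.integral_of_le zero_le_one]
  rw [integral_integral_swap]
  · refine integral_eq_zero_of_ae (ae_of_all _ fun t => ?_)
    have h1 : ∫ x, g (φ t x) ∂μ = ∫ x, g x ∂μ := by
      rw [← (hmp t).map_eq, integral_map (hmp t).aemeasurable hg.aestronglyMeasurable,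
        (hmp t).map_eq]
    simp [integral_const_mul, h1, hint]
  · refine Integrable.of_bound (C := C) ?_ (ae_of_all _ fun p => ?_)
    · exact (Measurable.mul (by fun_prop)
        (hg.comp (hφ.comp measurable_swap))).aestronglyMeasurable
    · simp only [Function.uncurry]
      rw [norm_mul, norm_exp_neg_two_pi_I_mul, one_mul]
      exact hC _

theorem ae_eq_zero_of_orbitFourierCoeff_ae_eq_zero
    (hφ : Measurable fun p : ℝ × X => φ p.1 p.2)
    (hmp : ∀ t, MeasurePreserving (φ t) μ μ) (hg : Measurable g) (hC : ∀ x, ‖g x‖ ≤ C)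
    (h0 : ∀ n, ∀ᵐ x ∂μ, orbitFourierCoeff φ g n x = 0) : ∀ᵐ x ∂μ, g x = 0 := by
  have h1 : ∀ᵐ x ∂μ, ∀ᵐ t ∂volume.restrict (Set.Ioc (0 : ℝ) 1), g (φ t x) = 0 := by
    filter_upwards [ae_all_iff.2 h0] with x hx
    exact ae_eq_zero_of_forall_fourier_eq_zero
      (hg.comp (hφ.comp (measurable_id.prodMk measurable_const))) (fun t => hC _) hx
  rw [Measure.ae_ae_comm (p := fun x t => g (φ t x) = 0)
    (measurableSet_eq_fun (hg.comp (hφ.comp measurable_swap)) measurable_const)] at h1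
  have : (ae (volume.restrict (Set.Ioc (0 : ℝ) 1))).NeBot := by
    rw [ae_restrict_neBot]; simp
  obtain ⟨t, ht⟩ := h1.exists
  rw [← (hmp t).map_eq]
  exact (ae_map_iff (hmp t).aemeasurable (hg (measurableSet_singleton 0))).2 ht

theorem orbitFourierCoeff_apply_flow (hφ : Measurable fun p : ℝ × X => φ p.1 p.2)
    (hmp : ∀ t, MeasurePreserving (φ t) μ μ) (hadd : ∀ s t x, φ s (φ t x) = φ (s + t) x)
    (hg : Measurable g) (hC : ∀ x, ‖g x‖ ≤ C) (hper : ∀ᵐ x ∂μ, g (φ 1 x) = g x)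
    (n : ℤ) : ∀ᵐ x ∂μ, ∀ s : ℝ, orbitFourierCoeff φ g n (φ s x) =
      Complex.exp (2 * Real.pi * Complex.I * (n * s)) * orbitFourierCoeff φ g n x := by
  have h1 : ∀ᵐ x ∂μ, ∀ᵐ t : ℝ, g (φ (t + 1) x) = g (φ t x) := by
    rw [Measure.ae_ae_comm]
    · refine ae_of_all _ fun t => ?_
      filter_upwards [(hmp t).quasiMeasurePreserving.ae hper] with x hx
      rw [add_comm, ← hadd, hx]
    · exact measurableSet_eq_fun
        (hg.comp (hφ.comp ((measurable_snd.add_const 1).prodMk measurable_fst)))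
        (hg.comp (hφ.comp measurable_swap))
  filter_upwards [h1] with x hx s
  set k : ℝ → ℂ := fun t => Complex.exp (-(2 * Real.pi * Complex.I * (n * t))) * g (φ t x) with hk
  have hkm : Measurable k := Measurable.mul (by fun_prop)
    (hg.comp (hφ.comp (measurable_id.prodMk measurable_const)))
  have hki : ∀ a b, IntervalIntegrable k volume a b := fun a b => by
    refine (intervalIntegrable_const (c := C)).mono_fun hkm.aestronglyMeasurable
      (ae_of_all _ fun t => ?_)
    simp only [hk]
    rw [norm_mul, norm_exp_neg_two_pi_I_mul, one_mul]
    exact (hC _).trans (le_abs_self C)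
  have hkp : ∀ᵐ t : ℝ, k (t + 1) = k t := by
    filter_upwards [hx] with t ht
    simp only [hk, ht]
    congr 1
    rw [Complex.exp_eq_exp_iff_exists_int]
    exact ⟨-n, by push_cast; ring⟩
  have hshift : ∫ t in s..s + 1, k t = ∫ t in (0 : ℝ)..1, k t := by
    have e1 : ∫ t in (0 : ℝ)..s, k (t + 1) = ∫ t in (0 : ℝ)..s, k t :=
      intervalIntegral.integral_congr_ae (hkp.mono fun t ht _ => ht)
    rw [intervalIntegral.integral_comp_add_right, zero_add] at e1
    have e2 := intervalIntegral.integral_add_adjacent_intervals (hki s 0) (hki 0 1)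
    have e3 := intervalIntegral.integral_add_adjacent_intervals (hki s 1) (hki 1 (s + 1))
    rw [← e3, ← e2, e1, intervalIntegral.integral_symm 0 s]
    ring
  calc orbitFourierCoeff φ g n (φ s x)
      = ∫ t in (0 : ℝ)..1, Complex.exp (2 * Real.pi * Complex.I * (n * s)) * k (t + s) := by
        unfold orbitFourierCoeff
        refine intervalIntegral.integral_congr fun t _ => ?_
        simp only [hk]
        rw [hadd, ← mul_assoc (Complex.exp _), ← Complex.exp_add]
        congr 2
        push_cast
        ring
    _ = Complex.exp (2 * Real.pi * Complex.I * (n * s)) * orbitFourierCoeff φ g n x := by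
        rw [intervalIntegral.integral_const_mul, intervalIntegral.integral_comp_add_right,
          zero_add, add_comm 1 s, hshift]
        rfl

end FlowFourier

namespace RSystem

variable {m : ℕ} {X : Type*} [MeasurableSpace X] {μ : Measure X}

/-- The isometry `f ↦ f ∘ T v` of `L²(μ)`. -/
noncomputable def koopman (S : RSystem m X μ) (v : Fin m → ℝ) : Lp ℂ 2 μ →ₗᵢ[ℂ] Lp ℂ 2 μ :=
  Lp.compMeasurePreservingₗᵢ ℂ (S.T v) (S.measurePreserving v)

variable (S : RSystem m X μ)

theorem koopman_ae_eq (v : Fin m → ℝ) (f : Lp ℂ 2 μ) :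
    S.koopman v f =ᵐ[μ] f ∘ S.T v :=
  Lp.coeFn_compMeasurePreserving f (S.measurePreserving v)

theorem koopman_zero (f : Lp ℂ 2 μ) : S.koopman 0 f = f := by
  refine Lp.ext ((S.koopman_ae_eq 0 f).trans ?_)
  rw [S.T_zero, Function.comp_id]

theorem koopman_add (a b : Fin m → ℝ) (f : Lp ℂ 2 μ) :
    S.koopman (a + b) f = S.koopman a (S.koopman b f) := by
  refine Lp.ext ?_
  filter_upwards [S.koopman_ae_eq (a + b) f, S.koopman_ae_eq a (S.koopman b f),
    (S.measurePreserving a).quasiMeasurePreserving.ae (S.koopman_ae_eq b f)] with x h₁ h₂ h₃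
  rw [h₁, h₂, Function.comp_apply, Function.comp_apply, h₃, add_comm, ← S.T_add]
  rfl

theorem integral_koopman (v : Fin m → ℝ) (f : Lp ℂ 2 μ) :
    ∫ x, S.koopman v f x ∂μ = ∫ x, f x ∂μ := by
  rw [integral_congr_ae (S.koopman_ae_eq v f)]
  have h := (S.measurePreserving v).map_eq
  calc ∫ x, f (S.T v x) ∂μ = ∫ x, f x ∂(μ.map (S.T v)) :=
        (integral_map (S.measurePreserving v).aemeasurable
          (Lp.stronglyMeasurable f).aestronglyMeasurable).symm
    _ = ∫ x, f x ∂μ := by rw [h]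

variable [IsProbabilityMeasure μ]

/-- The functions in `L²(μ)` of mean zero. -/
noncomputable def meanZero (μ : Measure X) [IsProbabilityMeasure μ] : Submodule ℂ (Lp ℂ 2 μ) :=
  (ℂ ∙ indicatorConstLp 2 MeasurableSet.univ (measure_ne_top μ _) (1 : ℂ))ᗮ

theorem mem_meanZero {f : Lp ℂ 2 μ} : f ∈ meanZero μ ↔ ∫ x, f x ∂μ = 0 := by
  rw [meanZero, Submodule.mem_orthogonal_singleton_iff_inner_right,
    L2.inner_indicatorConstLp_one, Measure.restrict_univ]

variable {S}

theorem IsErgodic.eq_zero_of_koopman_eq (hS : S.IsErgodic) {f : Lp ℂ 2 μ}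
    (hf : f ∈ meanZero μ) (hinv : ∀ v, S.koopman v f = f) : f = 0 := by
  have hm : Measurable f := (Lp.stronglyMeasurable f).measurable
  obtain ⟨c, hc⟩ : ∃ c, f =ᵐ[μ] Function.const X c := by
    refine exists_eventuallyEq_const_of_forall_separating MeasurableSet fun B hB => ?_
    have h := hS (f ⁻¹' B) (hm hB) fun v => by
      rw [measure_symmDiff_eq_zero_iff]
      have h1 := S.koopman_ae_eq v f
      rw [hinv v] at h1
      filter_upwards [h1] with x hx
      change (f (S.T v x) ∈ B) = (f x ∈ B)
      rw [hx, Function.comp_apply]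
    rcases h with h | h
    · exact Or.inr (measure_eq_zero_iff_ae_notMem.1 h)
    · exact Or.inl ((prob_compl_eq_zero_iff (hm hB)).2 h)
  rw [mem_meanZero, integral_congr_ae hc] at hf
  have hc0 : c = 0 := by simpa using hf
  refine Lp.ext (hc.trans ?_)
  rw [hc0]
  exact (Lp.coeFn_zero _ _ _).symm

theorem exists_eigenfunction_of_invariant_set {α : Fin m → ℝ} {A : Set X}
    (hA : MeasurableSet A) (hinv : μ (symmDiff (S.T α ⁻¹' A) A) = 0)
    (h01 : ¬ (μ A = 0 ∨ μ A = 1)) :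
    ∃ n : ℤ, ∃ f ∈ meanZero μ, f ≠ 0 ∧ ∀ s : ℝ, S.koopman (s • α) f =
      Complex.exp (2 * Real.pi * Complex.I * (n * s)) • f := by
  classical
  set φ : ℝ → X → X := fun t => S.T (t • α) with hφdef
  set g : X → ℂ := fun x => A.indicator 1 x - (μ.real A : ℂ) with hgdef
  have hφ : Measurable fun p : ℝ × X => φ p.1 p.2 :=
    S.measurable_pair.comp ((measurable_fst.smul_const α).prodMk measurable_snd)
  have hmp : ∀ t, MeasurePreserving (φ t) μ μ := fun t => S.measurePreserving _
  have hadd : ∀ s t x, φ s (φ t x) = φ (s + t) x := fun s t x => by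
    simp only [hφdef, add_smul, ← S.T_add]
    rfl
  have hg : Measurable g := (measurable_one.indicator hA).sub_const _
  have hC : ∀ x, ‖g x‖ ≤ 2 := fun x => by
    refine (norm_sub_le _ _).trans ?_
    have h1 : ‖A.indicator (1 : X → ℂ) x‖ ≤ 1 := by
      by_cases hx : x ∈ A <;> simp [hx]
    have h2 : ‖(μ.real A : ℂ)‖ ≤ 1 := by
      rw [Complex.norm_real, Real.norm_of_nonneg measureReal_nonneg]
      exact measureReal_le_one
    linarith
  have hint : ∫ x, g x ∂μ = 0 := by
    have h1 : Integrable (A.indicator (1 : X → ℂ)) μ := (integrable_const (1 : ℂ)).indicator hA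
    rw [hgdef, integral_sub h1 (integrable_const _), integral_indicator hA]
    simp
  have hper : ∀ᵐ x ∂μ, g (φ 1 x) = g x := by
    rw [measure_symmDiff_eq_zero_iff] at hinv
    filter_upwards [hinv.mem_iff] with x hx
    have hx' : S.T α x ∈ A ↔ x ∈ A := hx
    simp only [hgdef, hφdef, one_smul, Set.indicator_apply, hx', Pi.one_apply]
  obtain ⟨n, hn⟩ : ∃ n, ¬ ∀ᵐ x ∂μ, orbitFourierCoeff φ g n x = 0 := by
    by_contra! h
    have h0 := ae_eq_zero_of_orbitFourierCoeff_ae_eq_zero hφ hmp hg hC h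
    refine h01 ?_
    by_cases hμ : μ A = 0
    · exact Or.inl hμ
    · right
      obtain ⟨x, hxA, hx⟩ := ((frequently_ae_mem_iff.2 hμ).and_eventually h0).exists
      have h1 : μ.real A = 1 := by
        have : (1 : ℂ) - (μ.real A : ℂ) = 0 := by simpa [hgdef, hxA] using hx
        exact_mod_cast (sub_eq_zero.1 this).symm
      rwa [measureReal_def, ENNReal.toReal_eq_one_iff] at h1
  have hL2 : MemLp (orbitFourierCoeff φ g n) 2 μ :=
    MemLp.of_bound (measurable_orbitFourierCoeff hφ hg n).aestronglyMeasurable 2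
      (ae_of_all _ (norm_orbitFourierCoeff_le hC n))
  refine ⟨n, hL2.toLp, ?_, fun h => hn ?_, fun s => Lp.ext ?_⟩
  · rw [mem_meanZero, integral_congr_ae hL2.coeFn_toLp]
    exact integral_orbitFourierCoeff hφ hmp hg hC hint n
  · filter_upwards [hL2.coeFn_toLp, Lp.coeFn_zero ℂ 2 μ] with x h₁ h₂
    rw [← h₁, h, h₂]
    rfl
  · filter_upwards [S.koopman_ae_eq (s • α) hL2.toLp, hL2.coeFn_toLp,
      (hmp s).quasiMeasurePreserving.ae hL2.coeFn_toLp,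
      orbitFourierCoeff_apply_flow hφ hmp hadd hg hC hper n,
      Lp.coeFn_smul (Complex.exp (2 * Real.pi * Complex.I * (n * s))) hL2.toLp]
      with x h₁ h₂ h₃ h₄ h₅
    rw [h₁, h₅, Pi.smul_apply, h₂, Function.comp_apply, smul_eq_mul, ← h₄ s]
    exact h₃

end RSystem

/-- For any ergodic `ℝ^m`-system, outside an at most countable union of
hyperplanes of `ℝ^m`, every map `T_α` is ergodic. -/
theorem T_alpha_ergodic_off_countably_many_hyperplanes
    (m : ℕ) (X : Type) [MeasurableSpace X] (μ : Measure X) [IsProbabilityMeasure μ]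
    (S : RSystem m X μ) (hS : S.IsErgodic) :
    ∃ L : Set (Set (Fin m → ℝ)), L.Countable ∧ (∀ ℓ ∈ L, IsHyperplane m ℓ) ∧
      ∀ α : Fin m → ℝ, α ∉ ⋃₀ L →
        ∀ A : Set X, MeasurableSet A → μ (symmDiff (S.T α ⁻¹' A) A) = 0 →
          μ A = 0 ∨ μ A = 1 := by
  have := S.separableL2
  let U : (Fin m → ℝ) → Lp ℂ 2 μ →L[ℂ] Lp ℂ 2 μ :=
    fun v => (S.koopman v).toContinuousLinearMap
  obtain ⟨M, hMc, hMne, hM⟩ := exists_countable_jointEigenspace_cover (U := U)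
    (K := RSystem.meanZero μ) S.koopman_zero S.koopman_add
    (fun v => (S.koopman v).inner_map_map) (Submodule.isClosed_orthogonal _)
    (fun v f hf => by
      rw [RSystem.mem_meanZero] at hf ⊢
      exact (S.integral_koopman v f).trans hf)
  have hproper : ∀ W ∈ M, ∃ v, ((v, 0) : (Fin m → ℝ) × ℝ) ∉ W := fun W hW => by
    by_contra! h
    refine hMne W hW ((Submodule.eq_bot_iff _).2 fun f hf => ?_)
    rw [mem_jointEigenspace] at hf
    refine hS.eq_zero_of_koopman_eq hf.1 fun v => ?_
    simpa [U] using hf.2 (v, 0) (h v)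
  choose! ℓ hℓ hsub using fun W hW (n : ℤ) => exists_isHyperplane_superset m W (hproper W hW) n
  refine ⟨Set.image2 ℓ M Set.univ, hMc.image2 Set.countable_univ _, ?_,
    fun α hα A hA hinv => ?_⟩
  · rintro _ ⟨W, hW, n, -, rfl⟩
    exact hℓ W hW n
  · by_contra h01
    obtain ⟨n, f, hf, hf0, hfn⟩ := RSystem.exists_eigenfunction_of_invariant_set hA hinv h01
    obtain ⟨W, hW, hle⟩ := hM (ℝ ∙ (α, (n : ℝ))) ((Submodule.ne_bot_iff _).2 ⟨f, by
      rw [mem_jointEigenspace]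
      refine ⟨hf, fun p hp => ?_⟩
      obtain ⟨s, rfl⟩ := Submodule.mem_span_singleton.1 hp
      refine (hfn s).trans ?_
      congr 2
      simp [mul_comm], hf0⟩)
    exact hα ⟨_, ⟨W, hW, n, trivial, rfl⟩,
      hsub W hW n (hle (Submodule.mem_span_singleton_self _))⟩
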